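/- Let f : (a₁,b₁) × (a₂,b₂) → ℝ be continuous in each variable separately, where (aᵢ,bᵢ) are open real intervals, and suppose x ↦ f(x,y) is monotone for every y ∈ (a₂,b₂). Then f is jointly continuous on (a₁,b₁) × (a₂,b₂). -/

import Mathlib

open Set Filter Topology


theorem young_intervals (a₁ b₁ a₂ b₂ : ℝ) (h₁ : a₁ < b₁) (h₂ : a₂ < b₂)
    (f : ℝ → ℝ → ℝ)
    (hcx : ∀ y ∈ Set.Ioo a₂ b₂, ContinuousOn (fun x => f x y) (Set.Ioo a₁ b₁))
    (hcy : ∀ x ∈ Set.Ioo a₁ b₁, ContinuousOn (fun y => f x y) (Set.Ioo a₂ b₂))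
    (hm : ∀ y ∈ Set.Ioo a₂ b₂,
      MonotoneOn (fun x => f x y) (Set.Ioo a₁ b₁) ∨
      AntitoneOn (fun x => f x y) (Set.Ioo a₁ b₁)) :
    ContinuousOn (fun p : ℝ × ℝ => f p.1 p.2) (Set.Ioo a₁ b₁ ×ˢ Set.Ioo a₂ b₂) := by
  rintro ⟨x₀, y₀⟩ ⟨hx₀, hy₀⟩
  refine ContinuousAt.continuousWithinAt (Metric.tendsto_nhds.2 fun ε hε => ?_)
  have hX : Ioo a₁ b₁ ∈ 𝓝 x₀ := isOpen_Ioo.mem_nhds hx₀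
  have hY : Ioo a₂ b₂ ∈ 𝓝 y₀ := isOpen_Ioo.mem_nhds hy₀
  have hx : ∀ᶠ x in 𝓝 x₀, dist (f x y₀) (f x₀ y₀) < ε :=
    Metric.tendsto_nhds.1 ((hcx y₀ hy₀).continuousAt hX) ε hε
  have hy : ∀ x ∈ Ioo a₁ b₁, dist (f x y₀) (f x₀ y₀) < ε →
      ∀ᶠ y in 𝓝 y₀, dist (f x y) (f x₀ y₀) < ε := fun x hx h =>
    (((hcy x hx).continuousAt hY).dist continuousAt_const).eventually_lt_const h
  obtain ⟨l, r, ⟨hl, hr⟩, hlr⟩ := mem_nhds_iff_exists_Ioo_subset.1 (hx.and hX)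
  obtain ⟨u, hlu, hu⟩ := exists_between hl
  obtain ⟨v, hv, hvr⟩ := exists_between hr
  obtain ⟨hfu, hu'⟩ := hlr ⟨hlu, by linarith⟩
  obtain ⟨hfv, hv'⟩ := hlr ⟨by linarith, hvr⟩
  change ∀ᶠ p : ℝ × ℝ in 𝓝 (x₀, y₀), dist (f p.1 p.2) (f x₀ y₀) < ε
  rw [nhds_prod_eq]
  filter_upwards [prod_mem_prod (Ioo_mem_nhds hu hv)
    (((hy u hu' hfu).and (hy v hv' hfv)).and hY)]
  rintro ⟨x, y⟩ ⟨⟨hux, hxv⟩, ⟨hyu, hyv⟩, hyY⟩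
  have hx' : x ∈ Ioo a₁ b₁ := ⟨hu'.1.trans hux, hxv.trans hv'.2⟩
  simp only [Real.dist_eq, abs_lt] at hyu hyv ⊢
  rcases hm y hyY with h | h <;>
  · have h1 := h hu' hx' hux.le
    have h2 := h hx' hv' hxv.le
    dsimp only at h1 h2
    constructor <;> linarith
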